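/- arXiv:1511.06102 — 2 statements merged into one kernel-verified Lean document; each statement's English description precedes it below -/
import Mathlib

section
/- Let k ≥ 4 be an even integer and let f be a cusp form of weight k for Γ₀(2). Let g = f|U₂ denote the cusp form of weight k for Γ₀(2) given by g(z) = (1/2)·(f(z/2) + f((z+1)/2)). Then for all x, y ∈ ℂ, r_g(x,y) = r_f(x,2y) + r_f(x+y,2y) − r_f(x+y,−2x). -/
open Complex MeasureTheory CongruenceSubgroup

noncomputable section

/-- Evaluation of a function on the upper half-plane at a complex number,
extended by `0` off the upper half-plane. -/
def fval (f : UpperHalfPlane → ℂ) (z : ℂ) : ℂ :=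
  if h : 0 < z.im then f ⟨z, h⟩ else 0

/-- The period polynomial `r_f(x,y) = i ∫_0^∞ f(it) (ity - x)^{k-2} dt`. -/
def rPoly (k : ℕ) (f : UpperHalfPlane → ℂ) (x y : ℂ) : ℂ :=
  I * ∫ t in Set.Ioi (0 : ℝ), fval f (I * t) * (I * t * y - x) ^ (k - 2)

open Filter Topology

/-- The filter of points tending to `i∞` inside the vertical strip `|re z| ≤ 2`. -/
def stripAtImInfty : Filter ℂ := comap im atTop ⊓ 𝓟 {z : ℂ | |z.re| ≤ 2}

/-- `h` decays faster than any power of `z` as `z → i∞` in the strip `|re z| ≤ 2`. -/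
def RapidDecay (h : ℂ → ℂ) : Prop :=
  ∀ N : ℕ, Tendsto (fun z ↦ z ^ N * h z) stripAtImInfty (𝓝 0)

theorem RapidDecay.linear_pow_mul {h : ℂ → ℂ} (hh : RapidDecay h) (a b : ℂ) (n : ℕ) :
    RapidDecay fun z ↦ h z * (z * a - b) ^ n := by
  induction n with
  | zero => simpa using hh
  | succ n ih =>
    intro N
    convert ((ih (N + 1)).const_mul a).sub ((ih N).const_mul b) using 2
    · ring
    · simp

theorem tendsto_line_stripAtImInfty {a : ℝ} (ha : |a| ≤ 2) {c : ℝ} (hc : 0 < c) :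
    Tendsto (fun t : ℝ ↦ (a : ℂ) + I * (c * t : ℝ)) atTop stripAtImInfty := by
  refine tendsto_inf.2 ⟨tendsto_comap_iff.2 ?_, tendsto_principal.2 (.of_forall fun t ↦ ?_)⟩
  · convert tendsto_id.const_mul_atTop hc using 2 with t
    simp
  · simpa using ha

theorem tendsto_primitive_sub_primitive {F P : ℂ → ℂ} (hF : Tendsto F stripAtImInfty (𝓝 0))
    (hP : ∀ z : ℂ, 0 < z.im → HasDerivAt P (F z) z) {a b : ℝ} (ha : |a| ≤ 2) (hb : |b| ≤ 2) :
    Tendsto (fun t : ℝ ↦ P (a + I * t) - P (b + I * t)) atTop (𝓝 0) := by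
  rw [Metric.tendsto_nhds]
  intro ε hε
  have hF' := Metric.tendsto_nhds.1 hF (ε / 5) (by positivity)
  rw [stripAtImInfty, eventually_inf_principal, eventually_comap] at hF'
  obtain ⟨A, hA⟩ := eventually_atTop.1 hF'
  filter_upwards [eventually_ge_atTop A, eventually_gt_atTop 0] with t ht ht0
  have hconv : Convex ℝ ({z : ℂ | t ≤ z.im} ∩ {z : ℂ | z.re ∈ Set.Icc (-2) 2}) :=
    (convex_halfSpace_im_ge t).inter ((convex_Icc (-2 : ℝ) 2).linear_preimage reLm)
  have hle := hconv.norm_image_sub_le_of_norm_hasDerivWithin_le (f := P) (f' := F) (C := ε / 5)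
    (x := b + I * t) (y := a + I * t)
    (fun z hz ↦ (hP z (ht0.trans_le hz.1)).hasDerivWithinAt)
    (fun z hz ↦ by simpa using (hA z.im (ht.trans hz.1) z rfl (abs_le.2 hz.2)).le)
    (by simpa using abs_le.1 hb) (by simpa using abs_le.1 ha)
  have hab : ‖((a : ℂ) + I * t) - (b + I * t)‖ ≤ 4 := by
    rw [show ((a : ℂ) + I * t) - (b + I * t) = (a - b : ℝ) by push_cast; ring, norm_real,
      Real.norm_eq_abs]
    exact (abs_sub a b).trans (by linarith)
  rw [dist_zero_right]
  nlinarith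

theorem integrableOn_Ioi_of_tendsto {u : ℝ → ℂ} (hu : ContinuousOn u (Set.Ioi 0))
    (htop : Tendsto (fun t : ℝ ↦ (t : ℂ) ^ 2 * u t) atTop (𝓝 0))
    (hzero : Tendsto (fun t : ℝ ↦ u t⁻¹) atTop (𝓝 0)) : IntegrableOn u (Set.Ioi 0) := by
  have hbot : Tendsto u (𝓝[>] 0) (𝓝 0) := by
    simpa [Function.comp_def] using hzero.comp tendsto_inv_nhdsGT_zero
  have := mellinConvergent_of_isBigO_rpow (f := u) (a := 2) (b := 0) (s := 1)
    (hu.locallyIntegrableOn measurableSet_Ioi) ?_ (by simp) ?_ (by simp)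
  · simpa [MellinConvergent] using this
  · refine (((htop.isBigO_one ℝ).norm_left.mul
      (Asymptotics.isBigO_refl (fun t : ℝ ↦ t ^ (-2 : ℝ)) atTop)).congr' ?_ (by simp)).of_norm_left
    filter_upwards [eventually_gt_atTop 0] with t ht
    rw [Real.rpow_neg ht.le, Real.rpow_two]
    simp
    field_simp
  · simpa using hbot.isBigO_one ℝ

theorem tendsto_intervalIntegral_Ioi_zero {u : ℝ → ℂ} (hu : IntegrableOn u (Set.Ioi 0))
    {c : ℝ} (hc : 0 < c) :
    Tendsto (fun t : ℝ ↦ ∫ s in (c * t)⁻¹..t, u s) atTop (𝓝 (∫ s in Set.Ioi 0, u s)) := by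
  have h0 : Tendsto (fun t : ℝ ↦ (c * t)⁻¹) atTop (𝓝 0) :=
    tendsto_inv_atTop_zero.comp (tendsto_id.const_mul_atTop hc)
  have h1 := intervalIntegral_tendsto_integral_Ioi (b := id) 0 hu tendsto_id
  have hint : ∀ a b : ℝ, 0 ≤ a → 0 ≤ b → IntervalIntegrable u volume a b := fun a b ha hb ↦
    intervalIntegrable_iff.2 (hu.mono_set fun x hx ↦ (le_min ha hb).trans_lt hx.1)
  have h2 : Tendsto (fun t : ℝ ↦ ∫ s in (0 : ℝ)..(c * t)⁻¹, u s) atTop (𝓝 0) := by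
    have := intervalIntegral.continuousWithinAt_primitive (μ := volume) (f := u) (a := 0) (b₀ := 0)
      (b₁ := 0) (b₂ := 1) (by simp) (by simpa using hint 0 1 le_rfl zero_le_one)
    rw [ContinuousWithinAt, intervalIntegral.integral_same] at this
    refine this.comp (tendsto_nhdsWithin_iff.2 ⟨h0, ?_⟩)
    filter_upwards [h0.eventually_le_const one_pos, eventually_gt_atTop 0] with t ht ht0
    exact ⟨by positivity, ht⟩
  refine (by simpa using h1.sub h2 : Tendsto _ _ _).congr' ?_
  filter_upwards [eventually_gt_atTop 0] with t ht
  have := intervalIntegral.integral_add_adjacent_intervals (hint 0 (c * t)⁻¹ le_rfl (by positivity))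
    (hint (c * t)⁻¹ t (by positivity) ht.le)
  rw [← this]; simp

theorem tendsto_primitive_vertical {F P : ℂ → ℂ} (hP : ∀ z : ℂ, 0 < z.im → HasDerivAt P (F z) z)
    (a : ℂ) (ha : a.im = 0) (hF : IntegrableOn (fun t : ℝ ↦ F (a + I * t)) (Set.Ioi 0))
    {c : ℝ} (hc : 0 < c) :
    Tendsto (fun t : ℝ ↦ P (a + I * t) - P (a + I * ((c * t)⁻¹ : ℝ))) atTop
      (𝓝 (I * ∫ t in Set.Ioi (0 : ℝ), F (a + I * t))) := by
  refine ((tendsto_intervalIntegral_Ioi_zero hF hc).const_mul I).congr' ?_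
  filter_upwards [eventually_gt_atTop 0] with t ht
  rw [← intervalIntegral.integral_const_mul]
  have hpos : ∀ s ∈ Set.uIcc (c * t)⁻¹ t, 0 < s := fun s hs ↦
    (lt_min (by positivity) ht).trans_le hs.1
  refine intervalIntegral.integral_eq_sub_of_hasDerivAt (f := fun s : ℝ ↦ P (a + I * s))
    (fun s hs ↦ ?_) ?_
  · have hl : HasDerivAt (fun s : ℝ ↦ a + I * s) I s := by
      simpa using ((hasDerivAt_id s).ofReal_comp.const_mul I).const_add a
    have := (hP (a + I * s) (by simpa [ha] using hpos s hs)).comp s hl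
    rwa [mul_comm] at this
  · exact (intervalIntegrable_iff.2 (hF.mono_set fun x hx ↦
      hpos x (Set.uIoc_subset_uIcc hx))).const_mul I


/-- A holomorphic function on the upper half-plane has a primitive there. -/
theorem exists_primitive_upperHalfPlane {F : ℂ → ℂ}
    (hF : DifferentiableOn ℂ F {z | 0 < z.im}) :
    ∃ P : ℂ → ℂ, ∀ z : ℂ, 0 < z.im → HasDerivAt P (F z) z := by
  have hne : ∀ w ∈ Metric.ball (0 : ℂ) 1, 1 - w ≠ 0 := fun w hw h ↦ by
    rw [← sub_eq_zero.1 h] at hw; simp at hw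
  have hmaps : Set.MapsTo (fun w : ℂ ↦ I * (1 + w) / (1 - w)) (Metric.ball 0 1)
      {z | 0 < z.im} := fun w hw ↦ by
    have h1 : 0 < normSq (1 - w) := normSq_pos.2 (hne w hw)
    have h2 : w.re * w.re + w.im * w.im < 1 := by
      rw [mem_ball_zero_iff] at hw
      rw [← normSq_apply, normSq_eq_norm_sq]
      exact pow_lt_one₀ (norm_nonneg w) hw two_ne_zero
    have h3 : (I * (1 + w) / (1 - w)).im
        = (1 - (w.re * w.re + w.im * w.im)) / normSq (1 - w) := by
      simp [div_im]
      ring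
    rw [Set.mem_ofPred_eq, h3]
    exact div_pos (by linarith) h1
  have hG : DifferentiableOn ℂ (fun w : ℂ ↦ F (I * (1 + w) / (1 - w)) * (2 * I / (1 - w) ^ 2))
      (Metric.ball 0 1) := by
    refine (hF.comp ?_ hmaps).mul ?_
    · exact .div (by fun_prop) (by fun_prop) hne
    · exact .div (by fun_prop) (by fun_prop) fun w hw ↦ pow_ne_zero 2 (hne w hw)
  obtain ⟨Q, hQ⟩ := hG.isExactOn_ball
  refine ⟨fun z ↦ Q ((z - I) / (z + I)), fun z hz ↦ ?_⟩
  have hzI : z + I ≠ 0 := fun h ↦ by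
    have := congrArg im h
    simp at this
    linarith
  have hw : (z - I) / (z + I) ∈ Metric.ball (0 : ℂ) 1 := by
    rw [mem_ball_zero_iff, norm_div, div_lt_one (norm_pos_iff.2 hzI),
      ← sq_lt_sq₀ (norm_nonneg _) (norm_nonneg _), ← normSq_eq_norm_sq, ← normSq_eq_norm_sq,
      normSq_apply, normSq_apply]
    simp
    linarith
  have hder : HasDerivAt (fun z : ℂ ↦ (z - I) / (z + I)) (2 * I / (z + I) ^ 2) z := by
    refine (((hasDerivAt_id' z).sub_const I).div ((hasDerivAt_id' z).add_const I) hzI).congr_deriv ?_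
    ring
  have hsub : 1 - (z - I) / (z + I) = 2 * I / (z + I) := by field_simp; ring
  have hadd : 1 + (z - I) / (z + I) = 2 * z / (z + I) := by field_simp; ring
  refine ((hQ _ hw).comp z hder).congr_deriv ?_
  beta_reduce
  rw [hsub, hadd, show I * (2 * z / (z + I)) / (2 * I / (z + I)) = z by field_simp [I_ne_zero]]
  field_simp [I_ne_zero]

theorem continuousOn_vertical {F : ℂ → ℂ} (hF : DifferentiableOn ℂ F {z | 0 < z.im})
    {a : ℂ} (ha : a.im = 0) : ContinuousOn (fun t : ℝ ↦ F (a + I * t)) (Set.Ioi 0) :=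
  hF.continuousOn.comp (by fun_prop) fun t ht ↦ by simpa [ha] using ht

section Periods

variable {h g : ℂ → ℂ} {m : ℕ}

theorem integrableOn_axis (hd : DifferentiableOn ℂ h {z | 0 < z.im}) (hh : RapidDecay h)
    (hg : RapidDecay g) (hS : ∀ z : ℂ, 0 < z.im → h (-z⁻¹) = z ^ (m + 2) * g z) (a b : ℂ) :
    IntegrableOn (fun t : ℝ ↦ h (I * t) * (I * t * a - b) ^ m) (Set.Ioi 0) := by
  have hl : Tendsto (fun t : ℝ ↦ I * t) atTop stripAtImInfty := by
    simpa using tendsto_line_stripAtImInfty (a := 0) (by simp) one_pos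
  refine integrableOn_Ioi_of_tendsto ?_ ?_ ?_
  · simpa using continuousOn_vertical (a := 0) (F := fun z ↦ h z * (z * a - b) ^ m)
      (hd.mul (by fun_prop)) (by simp)
  · convert ((hh.linear_pow_mul a b m 2).comp hl).neg using 2 with t
    · simp [mul_pow]
    · simp
  · refine ((hg.linear_pow_mul (-b) a m 2).comp hl).congr' ?_
    filter_upwards [eventually_gt_atTop 0] with t ht
    have ht' : (t : ℂ) ≠ 0 := by exact_mod_cast ht.ne'
    have hz : I * ((t⁻¹ : ℝ) : ℂ) = -(I * t)⁻¹ := by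
      rw [mul_inv, inv_I]; push_cast; ring
    have hz0 : I * (t : ℂ) ≠ 0 := mul_ne_zero I_ne_zero ht'
    rw [hz, hS _ (by simpa using ht), Function.comp_apply]
    generalize I * (t : ℂ) = z at hz0
    rw [show z * -b - a = z * (-z⁻¹ * a - b) by field_simp; ring, mul_pow]
    ring

theorem integrableOn_half (hd : DifferentiableOn ℂ h {z | 0 < z.im}) (hh : RapidDecay h)
    (hγ : ∀ z : ℂ, 0 < z.im → h (z / (2 * z + 1)) = (2 * z + 1) ^ (m + 2) * h z) (a b : ℂ) :
    IntegrableOn (fun t : ℝ ↦ h (1 / 2 + I * t) * ((1 / 2 + I * t) * a - b) ^ m) (Set.Ioi 0) := by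
  have hl : Tendsto (fun t : ℝ ↦ 1 / 2 + I * t) atTop stripAtImInfty := by
    simpa using tendsto_line_stripAtImInfty (a := 1 / 2) (by norm_num [abs_le]) one_pos
  have hl' : Tendsto (fun t : ℝ ↦ -1 / 2 + I * (1 / 4 * t)) atTop stripAtImInfty := by
    simpa using tendsto_line_stripAtImInfty (a := -1 / 2) (c := 1 / 4) (by norm_num [abs_le])
      (by norm_num)
  refine integrableOn_Ioi_of_tendsto ?_ ?_ ?_
  · exact continuousOn_vertical (F := fun z ↦ h z * (z * a - b) ^ m)
      (hd.mul (by fun_prop)) (by simp)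
  · have hr := hh.linear_pow_mul a b m
    convert (((hr 2).sub (hr 1)).add ((hr 0).const_mul (1 / 4))).neg.comp hl using 2 with t
    · simp only [Function.comp_apply]
      generalize h (1 / 2 + I * t) * ((1 / 2 + I * t) * a - b) ^ m = w
      linear_combination ((t : ℂ) ^ 2 * w) * I_sq
    · simp
  · refine (((hh.linear_pow_mul (a - 2 * b) b m).linear_pow_mul 2 (-1) 2 0).comp hl').congr' ?_
    filter_upwards [eventually_gt_atTop 0] with t ht
    have ht' : (t : ℂ) ≠ 0 := by exact_mod_cast ht.ne'
    have hz0 : 2 * (-1 / 2 + I * (1 / 4 * t)) + 1 ≠ 0 := by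
      ring_nf
      simp [ht']
    have hz : 1 / 2 + I * ((t⁻¹ : ℝ) : ℂ)
        = (-1 / 2 + I * (1 / 4 * t)) / (2 * (-1 / 2 + I * (1 / 4 * t)) + 1) := by
      rw [eq_div_iff hz0]
      push_cast
      field_simp
      linear_combination (4 * (t : ℂ)) * I_sq
    rw [hz, hγ _ (by simpa using ht), Function.comp_apply]
    generalize -1 / 2 + I * (1 / 4 * (t : ℂ)) = z at hz0
    rw [show z * (a - 2 * b) - b = (2 * z + 1) * (z / (2 * z + 1) * a - b) by
      linear_combination (-a) * div_mul_cancel₀ z hz0, mul_pow]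
    ring

theorem integral_axis_sub_integral_half (hd : DifferentiableOn ℂ h {z | 0 < z.im})
    (hh : RapidDecay h) (hg : RapidDecay g)
    (hS : ∀ z : ℂ, 0 < z.im → h (-z⁻¹) = z ^ (m + 2) * g z)
    (hγ : ∀ z : ℂ, 0 < z.im → h (z / (2 * z + 1)) = (2 * z + 1) ^ (m + 2) * h z) (a b : ℂ) :
    (∫ t in Set.Ioi (0 : ℝ), h (I * t) * (I * t * a - b) ^ m)
      - (∫ t in Set.Ioi (0 : ℝ), h (1 / 2 + I * t) * ((1 / 2 + I * t) * a - b) ^ m)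
      = ∫ t in Set.Ioi (0 : ℝ), h (I * t) * (I * t * (a - 2 * b) - b) ^ m := by
  obtain ⟨P, hP⟩ := exists_primitive_upperHalfPlane (F := fun z ↦ h z * (z * a - b) ^ m)
    (hd.mul (by fun_prop))
  have hPγ : ∀ z : ℂ, 0 < z.im → HasDerivAt (fun z ↦ P (z / (2 * z + 1)))
      (h z * (z * (a - 2 * b) - b) ^ m) z := fun z hz ↦ by
    have hz0 : 2 * z + 1 ≠ 0 := fun h ↦ by simpa [hz.ne'] using congrArg im h
    have him : 0 < (z / (2 * z + 1)).im := by
      have : (z / (2 * z + 1)).im = z.im / normSq (2 * z + 1) := by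
        simp [div_im]
        ring
      rw [this]
      exact div_pos hz (normSq_pos.2 hz0)
    have hder : HasDerivAt (fun z : ℂ ↦ z / (2 * z + 1)) (1 / (2 * z + 1) ^ 2) z := by
      refine ((hasDerivAt_id' z).div (((hasDerivAt_id' z).const_mul 2).add_const 1)
        hz0).congr_deriv ?_
      ring
    refine ((hP _ him).comp z hder).congr_deriv ?_
    rw [hγ z hz, show z * (a - 2 * b) - b = (2 * z + 1) * (z / (2 * z + 1) * a - b) by
      linear_combination (-a) * div_mul_cancel₀ z hz0, mul_pow]
    field_simp
    ring
  have hPS : ∀ z : ℂ, 0 < z.im → HasDerivAt (fun z ↦ P (-z⁻¹))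
      (g z * (z * (-b) - a) ^ m) z := fun z hz ↦ by
    have hz0 : z ≠ 0 := fun h ↦ by simp [h] at hz
    have him : 0 < (-z⁻¹).im := by
      simpa [inv_im, neg_div] using div_pos hz (normSq_pos.2 hz0)
    have hder : HasDerivAt (fun z : ℂ ↦ -z⁻¹) (1 / z ^ 2) z := by
      exact (hasDerivAt_inv hz0).neg.congr_deriv (by simp)
    refine ((hP _ him).comp z hder).congr_deriv ?_
    rw [hS z hz, show z * -b - a = z * (-z⁻¹ * a - b) by field_simp; ring, mul_pow]
    field_simp
    ring
  have hA := tendsto_primitive_vertical hP 0 (by simp)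
    (by simpa using integrableOn_axis hd hh hg hS a b) one_pos
  have hB := tendsto_primitive_vertical hP (1 / 2) (by simp)
    (integrableOn_half hd hh hγ a b) (c := 4) (by norm_num)
  have hC := tendsto_primitive_vertical hPγ 0 (by simp)
    (by simpa using integrableOn_axis hd hh hg hS (a - 2 * b) b) one_pos
  have hzero : ∀ {k : ℂ → ℂ}, RapidDecay k → Tendsto k stripAtImInfty (𝓝 0) := fun hk ↦ by
    simpa using hk 0
  have h1 := tendsto_primitive_sub_primitive (hzero (hh.linear_pow_mul a b m)) hP
    (a := 0) (b := 1 / 2) (by simp) (by norm_num [abs_le])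
  have h2 := tendsto_primitive_sub_primitive (hzero (hh.linear_pow_mul (a - 2 * b) b m)) hPγ
    (a := -1 / 2) (b := 0) (by norm_num [abs_le]) (by simp)
  have h3 := tendsto_primitive_sub_primitive (hzero (hg.linear_pow_mul (-b) a m)) hPS
    (a := -2) (b := 0) (by simp) (by simp)
  have heq := tendsto_nhds_unique (((hA.sub hB).sub hC).congr' ?_) ((h1.add h2).add h3)
  · have : I * ((∫ t in Set.Ioi (0 : ℝ), h (I * t) * (I * t * a - b) ^ m)
      - (∫ t in Set.Ioi (0 : ℝ), h (1 / 2 + I * t) * ((1 / 2 + I * t) * a - b) ^ m)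
      - ∫ t in Set.Ioi (0 : ℝ), h (I * t) * (I * t * (a - 2 * b) - b) ^ m) = 0 := by
      simpa [mul_sub] using heq
    exact sub_eq_zero.1 ((mul_eq_zero.1 this).resolve_left I_ne_zero)
  · filter_upwards [eventually_gt_atTop 0] with t ht
    have ht' : (t : ℂ) ≠ 0 := by exact_mod_cast ht.ne'
    have hIt : I * (t : ℂ) ≠ 0 := mul_ne_zero I_ne_zero ht'
    have e1 : (1 / 2 : ℂ) + I * (((4 * t)⁻¹ : ℝ) : ℂ)
        = (-1 / 2 + I * t) / (2 * (-1 / 2 + I * t) + 1) := by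
      rw [eq_div_iff (by ring_nf; simp [ht'])]
      push_cast
      field_simp
      linear_combination (4 * (t : ℂ)) * I_sq
    have e2 : -(I * (t : ℂ))⁻¹ = I * ((t⁻¹ : ℝ) : ℂ) := by
      rw [mul_inv, inv_I]; push_cast; ring
    have e3 : -(-2 + I * (t : ℂ))⁻¹ = (I * ((t⁻¹ : ℝ) : ℂ)) / (2 * (I * ((t⁻¹ : ℝ) : ℂ)) + 1) := by
      have h0 : -2 + I * (t : ℂ) ≠ 0 := fun h ↦ by simpa [ht.ne'] using congrArg im h
      have h0' : 2 * (I * ((t⁻¹ : ℝ) : ℂ)) + 1 ≠ 0 := fun h ↦ by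
        simpa [ht.ne'] using congrArg im h
      rw [eq_div_iff h0', neg_mul, inv_mul_eq_div, neg_eq_iff_eq_neg, div_eq_iff h0]
      push_cast
      field_simp
      linear_combination (t : ℂ) * I_sq
    simp only [zero_add, one_mul, e1, ofReal_zero, ofReal_div, ofReal_neg, ofReal_one, ofReal_ofNat,
      e2, e3]
    ring

end Periods

theorem fval_of_im_pos (f : UpperHalfPlane → ℂ) {z : ℂ} (hz : 0 < z.im) :
    fval f z = f ⟨z, hz⟩ := dif_pos hz

open scoped Manifold in
theorem differentiableOn_fval {f : UpperHalfPlane → ℂ}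
    (hf : MDifferentiable 𝓘(ℂ) 𝓘(ℂ) f) : DifferentiableOn ℂ (fval f) {z | 0 < z.im} :=
  (UpperHalfPlane.mdifferentiable_iff.1 hf).congr fun z hz ↦ by
    rw [fval_of_im_pos f hz, Function.comp_apply, UpperHalfPlane.ofComplex_apply_of_im_pos hz]

theorem rapidDecay_fval {φ : UpperHalfPlane → ℂ} {c : ℝ} (hc : 0 < c)
    (hφ : φ =O[UpperHalfPlane.atImInfty] fun τ ↦ Real.exp (-c * τ.im)) :
    RapidDecay (fval φ) := fun N ↦ by
  obtain ⟨C, hC⟩ := hφ.bound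
  obtain ⟨A, hA⟩ := (UpperHalfPlane.atImInfty_mem _).1 hC
  have hlim : Tendsto (fun z : ℂ ↦ 3 ^ N * C * (z.im ^ (N : ℝ) * Real.exp (-c * z.im)))
      stripAtImInfty (𝓝 0) := by
    have := (tendsto_rpow_mul_exp_neg_mul_atTop_nhds_zero N c hc).const_mul (3 ^ N * C)
    rw [mul_zero] at this
    exact this.comp (tendsto_comap.mono_left inf_le_left)
  refine squeeze_zero_norm' ?_ hlim
  have him : ∀ᶠ z in stripAtImInfty, max A 1 ≤ z.im :=
    (tendsto_comap.mono_left inf_le_left).eventually (eventually_ge_atTop _)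
  have hre : ∀ᶠ z in stripAtImInfty, |z.re| ≤ 2 := mem_inf_of_right (mem_principal_self _)
  filter_upwards [him, hre] with z h1 h2
  have h3 : 1 ≤ z.im := (le_max_right _ _).trans h1
  have hz : 0 < z.im := by linarith
  have h4 : ‖z‖ ≤ 3 * z.im := by
    have := norm_le_abs_re_add_abs_im z
    rw [abs_of_pos hz] at this
    linarith
  have h5 : ‖fval φ z‖ ≤ C * Real.exp (-c * z.im) := by
    have := hA ⟨z, hz⟩ ((le_max_left _ _).trans h1)
    simpa [fval_of_im_pos φ hz] using this
  rw [norm_mul, norm_pow, Real.rpow_natCast]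
  calc ‖z‖ ^ N * ‖fval φ z‖ ≤ (3 * z.im) ^ N * (C * Real.exp (-c * z.im)) := by gcongr
    _ = _ := by rw [mul_pow]; ring

section CuspForms

variable {m : ℕ} (f : CuspForm (Gamma0 2) ((m + 2 : ℕ) : ℤ))

theorem rapidDecay_cuspForm : RapidDecay (fval f) := by
  obtain ⟨c, hc, h⟩ := CuspFormClass.exp_decay_atImInfty' f
  exact rapidDecay_fval hc h

open ConjAct Pointwise MatrixGroups in
theorem exists_rapidDecay_neg_inv :
    ∃ g : ℂ → ℂ, RapidDecay g ∧ ∀ z : ℂ, 0 < z.im → fval f (-z⁻¹) = z ^ (m + 2) * g z := by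
  have : (toConjAct (ModularGroup.S : GL (Fin 2) ℝ)⁻¹ •
      (Gamma0 2 : Subgroup (GL (Fin 2) ℝ))).IsArithmetic := by
    convert Subgroup.IsArithmetic.conj (Gamma0 2 : Subgroup (GL (Fin 2) ℝ)) ↑(ModularGroup.S⁻¹)
    simp only [ModularGroup.S_inv, ← map_inv]
    ext i j
    fin_cases i <;> fin_cases j <;> simp [ModularGroup.S]
  obtain ⟨c, hc, h⟩ := CuspFormClass.exp_decay_atImInfty'
    (CuspForm.translate f (ModularGroup.S : GL (Fin 2) ℝ))
  refine ⟨_, rapidDecay_fval hc h, fun z hz ↦ ?_⟩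
  have hz0 : z ≠ 0 := fun h ↦ by simp [h] at hz
  have him : 0 < (-z⁻¹).im := by
    simpa [inv_im, neg_div] using div_pos hz (normSq_pos.2 hz0)
  have hS := ModularForm.SL_slash_apply (f := f) (k := ((m + 2 : ℕ) : ℤ)) ModularGroup.S ⟨z, hz⟩
  rw [UpperHalfPlane.modular_S_smul, ModularGroup.denom_S, zpow_neg, zpow_natCast] at hS
  rw [fval_of_im_pos _ hz, fval_of_im_pos _ him, CuspForm.coe_translate]
  erw [hS]
  simp only [inv_neg]
  field_simp

theorem fval_div_two_mul_add_one {z : ℂ} (hz : 0 < z.im) :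
    fval f (z / (2 * z + 1)) = (2 * z + 1) ^ (m + 2) * fval f z := by
  let γ : Matrix.SpecialLinearGroup (Fin 2) ℤ := ⟨!![1, 0; 2, 1], by simp⟩
  have hγ : γ ∈ Gamma0 2 := by
    rw [Gamma0_mem]
    change ((2 : ℤ) : ZMod 2) = 0
    decide
  have hact := UpperHalfPlane.coe_specialLinearGroup_apply γ ⟨z, hz⟩
  have him := (γ • (⟨z, hz⟩ : UpperHalfPlane)).im_pos
  have hval := SlashInvariantForm.slash_action_eqn_SL'' f hγ ⟨z, hz⟩
  have hγz : ((γ • (⟨z, hz⟩ : UpperHalfPlane) : UpperHalfPlane) : ℂ) = z / (2 * z + 1) := by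
    simpa [γ] using hact
  have hden : UpperHalfPlane.denom γ (⟨z, hz⟩ : UpperHalfPlane) = 2 * z + 1 := by
    rw [ModularGroup.denom_apply]
    simp [γ]
  rw [hden, zpow_natCast] at hval
  rw [fval_of_im_pos _ hz, ← hval, ← hγz, fval_of_im_pos _ him]

end CuspForms

theorem integrableOn_comp_half_mul {u : ℝ → ℂ} (hu : IntegrableOn u (Set.Ioi 0)) :
    IntegrableOn (fun t ↦ u (1 / 2 * t)) (Set.Ioi 0) := by
  rw [integrableOn_Ioi_comp_mul_left_iff u 0 (by norm_num : (0 : ℝ) < 1 / 2)]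
  simpa using hu

theorem integral_comp_half_mul (u : ℝ → ℂ) :
    ∫ t in Set.Ioi (0 : ℝ), u (1 / 2 * t) = 2 * ∫ t in Set.Ioi (0 : ℝ), u t := by
  rw [integral_comp_mul_left_Ioi u 0 (by norm_num)]
  simp

/-- Lemma: the period polynomial of `f|U₂` for a cusp form `f` of weight `k` on `Γ₀(2)`
satisfies `r_{f|U₂}(x,y) = r_f(x,2y) + r_f(x+y,2y) - r_f(x+y,-2x)`. -/
theorem stmt4 (k : ℕ) (hk : 4 ≤ k) (hke : Even k)
    (f g : CuspForm (Gamma0 2) (k : ℤ))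
    (hg : ∀ z : ℂ, 0 < z.im →
      fval g z = (1 / 2) * (fval f (z / 2) + fval f ((z + 1) / 2))) :
    ∀ x y : ℂ, rPoly k g x y
      = rPoly k f x (2 * y) + rPoly k f (x + y) (2 * y) - rPoly k f (x + y) (-2 * x) := by
  intro x y
  obtain ⟨m, rfl⟩ : ∃ m, k = m + 2 := ⟨k - 2, by omega⟩
  have hd := differentiableOn_fval (CuspFormClass.holo f)
  have hh := rapidDecay_cuspForm f
  obtain ⟨s, hs, hS⟩ := exists_rapidDecay_neg_inv f
  have hγ : ∀ z : ℂ, 0 < z.im → fval f (z / (2 * z + 1)) = (2 * z + 1) ^ (m + 2) * fval f z :=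
    fun z hz ↦ fval_div_two_mul_add_one f hz
  have key := integral_axis_sub_integral_half hd hh hs hS hγ (2 * y) (x + y)
  have i1 := integrableOn_comp_half_mul (integrableOn_axis hd hh hs hS (2 * y) x)
  have i2 := integrableOn_comp_half_mul (integrableOn_half hd hh hγ (2 * y) (x + y))
  have hu : ∫ t in Set.Ioi (0 : ℝ), fval g (I * t) * (I * t * y - x) ^ m
      = (∫ t in Set.Ioi (0 : ℝ), fval f (I * t) * (I * t * (2 * y) - x) ^ m)
        + ∫ t in Set.Ioi (0 : ℝ),
          fval f (1 / 2 + I * t) * ((1 / 2 + I * t) * (2 * y) - (x + y)) ^ m := by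
    have hsum := (integral_add i1 i2).symm
    rw [integral_comp_half_mul fun t : ℝ ↦ fval f (I * t) * (I * t * (2 * y) - x) ^ m,
      integral_comp_half_mul fun t : ℝ ↦
        fval f (1 / 2 + I * t) * ((1 / 2 + I * t) * (2 * y) - (x + y)) ^ m, ← mul_add] at hsum
    rw [← mul_right_inj' (two_ne_zero (α := ℂ)), hsum, ← integral_const_mul]
    refine setIntegral_congr_fun measurableSet_Ioi fun t ht ↦ ?_
    rw [hg (I * t) (by simpa using ht)]
    push_cast
    rw [show I * (1 / 2 * (t : ℂ)) = I * t / 2 by ring,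
      show 1 / 2 + I * (t : ℂ) / 2 = (I * t + 1) / 2 by ring]
    ring
  simp only [rPoly, Nat.add_sub_cancel]
  rw [hu, ← mul_add, ← mul_sub]
  congr 1
  rw [show -2 * x = 2 * y - 2 * (x + y) by ring, ← key]
  ring
end
end

section
/- Let k ≥ 4 be an even integer and let f be a cusp form of weight k for Γ₀(3). Let g = f|U₃ denote the cusp form of weight k for Γ₀(3) given by g(z) = (1/3)·(f(z/3) + f((z+1)/3) + f((z+2)/3)). Then for all x, y ∈ ℂ, r_g(x,y) = r_f(x,3y) + r_f(x+y,3y) − r_f(x+y,−3x) + r_f(x−y,3y) − r_f(−(x−y),−3x). -/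
open Complex MeasureTheory CongruenceSubgroup

noncomputable section

open Filter Topology Asymptotics
open scoped MatrixGroups ModularForm

/-- The weight `k` translate of `F` by the matrix `(a, b; c, d)` decays exponentially at `i∞`. -/
def DecaysAt (k : ℕ) (F : ℂ → ℂ) (a b c d : ℝ) : Prop :=
  ∃ C δ A : ℝ, 0 < δ ∧ ∀ z : ℂ, A ≤ z.im →
    ‖F ((a * z + b) / (c * z + d))‖ ≤ C * ‖(c * z + d : ℂ)‖ ^ k * Real.exp (-δ * z.im)

lemma fval_coe (f : UpperHalfPlane → ℂ) (τ : UpperHalfPlane) : fval f τ = f τ := by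
  simp [fval, τ.im_pos]

open ConjAct Pointwise Matrix.SpecialLinearGroup Matrix.GeneralLinearGroup in
lemma CuspForm.decaysAt {Γ : Subgroup (GL (Fin 2) ℝ)} [Γ.IsArithmetic] {k : ℕ}
    (f : CuspForm Γ (k : ℤ)) (γ : SL(2, ℤ)) :
    DecaysAt k (fval f) (γ 0 0) (γ 0 1) (γ 1 0) (γ 1 1) := by
  have : (toConjAct (mapGL ℝ γ)⁻¹ • Γ).IsArithmetic := by
    simpa [(show Rat.castHom ℝ = algebraMap ℚ ℝ by rfl), map_inv, map_mapGL]
      using! Subgroup.IsArithmetic.conj Γ (mapGL ℚ γ)⁻¹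
  obtain ⟨δ, hδ, hO⟩ := CuspFormClass.exp_decay_atImInfty' (CuspForm.translate f (mapGL ℝ γ))
  obtain ⟨C, hC⟩ := hO.bound
  obtain ⟨A, hA⟩ := (UpperHalfPlane.atImInfty_mem _).1 hC
  refine ⟨C, δ, max A 1, hδ, fun z hz ↦ ?_⟩
  have hz0 : 0 < z.im := zero_lt_one.trans_le ((le_max_right _ _).trans hz)
  have h := hA ⟨z, hz0⟩ ((le_max_left _ _).trans hz)
  set τ : UpperHalfPlane := ⟨z, hz0⟩
  have hsmul : (↑(γ • τ) : ℂ) = ((γ 0 0 : ℝ) * z + (γ 0 1 : ℝ)) / ((γ 1 0 : ℝ) * z + (γ 1 1 : ℝ)) :=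
    UpperHalfPlane.coe_specialLinearGroup_apply γ τ
  have hden : UpperHalfPlane.denom γ τ = (γ 1 0 : ℝ) * z + (γ 1 1 : ℝ) := rfl
  have hne : (γ 1 0 : ℝ) * z + (γ 1 1 : ℝ) ≠ 0 := hden ▸ UpperHalfPlane.denom_ne_zero _ τ
  have hval : CuspForm.translate f (mapGL ℝ γ) τ
      = f (γ • τ) * ((γ 1 0 : ℝ) * z + (γ 1 1 : ℝ)) ^ (-(k : ℤ)) := by
    rw [← hden]
    exact ModularForm.SL_slash_apply f γ τ
  rw [← hsmul, fval_coe]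
  simp only [Set.mem_ofPred_eq, hval, norm_mul, norm_inv, norm_pow, zpow_neg, zpow_natCast,
    Real.norm_eq_abs, Real.abs_exp] at h
  rw [← div_eq_mul_inv, div_le_iff₀ (by positivity)] at h
  calc _ ≤ _ := h
    _ = _ := mul_right_comm _ _ _

lemma CuspForm.differentiableOn_fval {Γ : Subgroup (GL (Fin 2) ℝ)} {k : ℤ} (f : CuspForm Γ k) :
    DifferentiableOn ℂ (fval f) {z | 0 < z.im} := by
  refine (UpperHalfPlane.mdifferentiable_iff.1 (CuspFormClass.holo f)).congr fun z hz ↦ ?_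
  simp [fval, UpperHalfPlane.ofComplex_apply_of_im_pos hz, show 0 < z.im from hz]

lemma fval_gamma0 {N : ℕ} {k : ℕ} (f : CuspForm (Gamma0 N) (k : ℤ)) {γ : SL(2, ℤ)}
    (hγ : γ ∈ Gamma0 N) {z : ℂ} (hz : 0 < z.im) :
    fval f ((γ 0 0 * z + γ 0 1) / (γ 1 0 * z + γ 1 1)) = (γ 1 0 * z + γ 1 1) ^ k * fval f z := by
  have h := SlashInvariantForm.slash_action_eqn_SL'' f hγ ⟨z, hz⟩
  rw [← fval_coe f, ← fval_coe f, UpperHalfPlane.coe_specialLinearGroup_apply] at h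
  simpa [UpperHalfPlane.denom] using h

lemma im_moebius_pos {a b c d : ℝ} (hdet : a * d - b * c = 1) {z : ℂ} (hz : 0 < z.im) :
    0 < ((a * z + b) / (c * z + d)).im := by
  have hne : (c * z + d : ℂ) ≠ 0 := by
    intro h
    have h1 := congrArg im h
    have h2 := congrArg re h
    simp at h1 h2
    rcases h1 with rfl | h1
    · simp at h2; subst h2; simp at hdet
    · exact hz.ne' h1
  have : ((a * z + b) / (c * z + d)).im = z.im / normSq (c * z + d) := by
    rw [Complex.div_im, ← sub_div]
    congr 1
    simp
    linear_combination z.im * hdet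
  rw [this]
  exact div_pos hz (normSq_pos.2 hne)

lemma moebius_denom_ne_zero {a b c d : ℝ} (hdet : a * d - b * c = 1) {z : ℂ} (hz : 0 < z.im) :
    (c * z + d : ℂ) ≠ 0 := by
  intro h
  simpa [h] using im_moebius_pos hdet hz

lemma hasDerivAt_moebius {a b c d : ℝ} (hdet : a * d - b * c = 1) {z : ℂ} (hz : 0 < z.im) :
    HasDerivAt (fun z : ℂ ↦ (a * z + b) / (c * z + d)) (((c * z + d : ℂ) ^ 2)⁻¹) z := by
  have h := (((hasDerivAt_id z).const_mul (a : ℂ)).add_const (b : ℂ)).div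
    (((hasDerivAt_id z).const_mul (c : ℂ)).add_const (d : ℂ)) (moebius_denom_ne_zero hdet hz)
  convert! h using 1
  rw [inv_eq_one_div]
  congr 1
  have : (a * d - b * c : ℂ) = 1 := by exact_mod_cast hdet
  simp
  linear_combination -this

lemma moebius_pullback (n : ℕ) (v α β : ℂ) {a b c d : ℝ} {z : ℂ} (hne : (c * z + d : ℂ) ≠ 0) :
    v * ((a * z + b) / (c * z + d) * α - β) ^ n * ((c * z + d : ℂ) ^ 2)⁻¹
      = v * ((c * z + d : ℂ) ^ (n + 2))⁻¹
        * (z * (a * α - c * β) + (b * α - d * β)) ^ n := by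
  have : (a * z + b) / (c * z + d) * α - β
      = (z * (a * α - c * β) + (b * α - d * β)) / (c * z + d) := by
    rw [eq_div_iff hne, sub_mul, mul_right_comm, div_mul_cancel₀ _ hne]
    ring
  rw [this, div_pow, pow_add]
  field_simp

/-- `G` is a primitive of `F(z) (z α - β) ^ n` on the upper half-plane. -/
def IsPrimitive (n : ℕ) (F : ℂ → ℂ) (α β : ℂ) (G : ℂ → ℂ) : Prop :=
  ∀ z : ℂ, 0 < z.im → HasDerivAt G (F z * (z * α - β) ^ n) z

lemma exists_isPrimitive (n : ℕ) {F : ℂ → ℂ} (hF : DifferentiableOn ℂ F {z | 0 < z.im})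
    (α β : ℂ) : ∃ G, IsPrimitive n F α β G := by
  have hw : DifferentiableOn ℂ (fun z ↦ F z * (z * α - β) ^ n) {z | 0 < z.im} :=
    hF.mul (by fun_prop)
  obtain ⟨G, hG⟩ := (convex_halfSpace_im_gt 0).exists_forall_hasDerivWithinAt hw
  exact ⟨G, fun z hz ↦ (hG z hz).hasDerivAt
    (UpperHalfPlane.isOpen_upperHalfPlaneSet.mem_nhds hz)⟩

lemma IsPrimitive.hasDerivAt_moebius {n : ℕ} {F G : ℂ → ℂ} {α β : ℂ} (hG : IsPrimitive n F α β G)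
    {a b c d : ℝ} (hdet : a * d - b * c = 1) {z : ℂ} (hz : 0 < z.im) :
    HasDerivAt (fun z : ℂ ↦ G ((a * z + b) / (c * z + d)))
      (F ((a * z + b) / (c * z + d)) * ((c * z + d : ℂ) ^ (n + 2))⁻¹
        * (z * (a * α - c * β) + (b * α - d * β)) ^ n) z := by
  rw [← moebius_pullback n _ _ _ (moebius_denom_ne_zero hdet hz)]
  exact (hG _ (im_moebius_pos hdet hz)).comp z (_root_.hasDerivAt_moebius hdet hz)

/-- A primitive varies less and less along horocycle segments moving into a cusp where `F`
decays. -/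
lemma IsPrimitive.tendsto_sub_horocycle {n : ℕ} {F G : ℂ → ℂ} {α β : ℂ}
    (hG : IsPrimitive n F α β G) {a b c d : ℝ} (hdet : a * d - b * c = 1)
    (hF : DecaysAt (n + 2) F a b c d) (r : ℝ) :
    Tendsto (fun T : ℝ ↦ G ((a * (I * T + r) + b) / (c * (I * T + r) + d))
      - G ((a * (I * T) + b) / (c * (I * T) + d))) atTop (𝓝 0) := by
  obtain ⟨C, δ, A, hδ, hC⟩ := hF
  set p : ℂ := a * α - c * β
  set q : ℂ := b * α - d * β
  set B : ℝ := (1 + |r|) * ‖p‖ + ‖q‖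
  have hlim : Tendsto (fun T : ℝ ↦ |C| * B ^ n * |r| * (T ^ (n : ℝ) * Real.exp (-δ * T)))
      atTop (𝓝 0) := by
    simpa using (tendsto_rpow_mul_exp_neg_mul_atTop_nhds_zero n δ hδ).const_mul (|C| * B ^ n * |r|)
  refine squeeze_zero_norm' ?_ hlim
  filter_upwards [eventually_ge_atTop (max A 1)] with T hT
  have hTA : A ≤ T := (le_max_left _ _).trans hT
  have hT1 : 1 ≤ T := (le_max_right _ _).trans hT
  have him : ∀ u : ℝ, (I * T + u * r : ℂ).im = T := fun u ↦ by simp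
  have hpos : ∀ u : ℝ, 0 < (I * T + u * r : ℂ).im := fun u ↦ by rw [him]; linarith
  have hderiv (u : ℝ) : HasDerivAt
      (fun u : ℝ ↦ G ((a * (I * T + u * r) + b) / (c * (I * T + u * r) + d))) _ u :=
    HasDerivAt.comp_ofReal (e := (fun z : ℂ ↦ G ((a * z + b) / (c * z + d))) ∘
      fun u : ℂ ↦ I * T + u * r) ((hG.hasDerivAt_moebius hdet (hpos u)).comp (u : ℂ)
        (((hasDerivAt_id (u : ℂ)).mul_const (r : ℂ)).const_add (I * T)))
  have key := norm_image_sub_le_of_norm_deriv_le_segment_01'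
    (C := |C| * B ^ n * |r| * (T ^ (n : ℝ) * Real.exp (-δ * T)))
    (fun u _ ↦ (hderiv u).hasDerivWithinAt) fun u hu ↦ ?_
  · simpa using key
  set z : ℂ := I * T + u * r with hz
  have hzim : z.im = T := him u
  have hne := moebius_denom_ne_zero hdet (hpos u)
  have h1 : ‖F ((a * z + b) / (c * z + d)) * ((c * z + d : ℂ) ^ (n + 2))⁻¹‖
      ≤ |C| * Real.exp (-δ * T) := by
    rw [norm_mul, norm_inv, norm_pow, ← div_eq_mul_inv, div_le_iff₀ (by positivity)]
    refine (hC z (hzim ▸ hTA)).trans ?_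
    rw [hzim, mul_right_comm]
    gcongr
    exact le_abs_self C
  have h2 : ‖z * p + q‖ ≤ B * T := by
    have hzn : ‖z‖ ≤ (1 + |r|) * T := by
      have hu1 : |u| ≤ 1 := abs_le.2 ⟨by linarith [hu.1], hu.2.le⟩
      calc ‖z‖ ≤ T + |u| * |r| := by
            refine (norm_add_le _ _).trans ?_
            simp [abs_of_nonneg (zero_le_one.trans hT1)]
        _ ≤ T + 1 * |r| * T := by
            refine add_le_add le_rfl ?_
            exact (mul_le_mul_of_nonneg_right hu1 (abs_nonneg r)).trans
              (le_mul_of_one_le_right (by positivity) hT1)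
        _ = _ := by ring
    calc ‖z * p + q‖ ≤ ‖z‖ * ‖p‖ + ‖q‖ := by
          refine (norm_add_le _ _).trans ?_
          rw [norm_mul]
      _ ≤ (1 + |r|) * T * ‖p‖ + ‖q‖ * T := by
          gcongr
          exact le_mul_of_one_le_right (norm_nonneg q) hT1
      _ = B * T := by ring
  simp only [one_mul, norm_mul (_ * _ : ℂ), norm_pow, norm_real, Real.norm_eq_abs]
  calc _ ≤ |C| * Real.exp (-δ * T) * (B * T) ^ n * |r| := by
        gcongr
    _ = _ := by rw [Real.rpow_natCast, mul_pow]; ring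

/-- Points of a vertical line lie in the upper half-plane. -/
lemma im_line_pos {x t : ℝ} (ht : 0 < t) : 0 < (x + I * t : ℂ).im := by simpa using ht

lemma integrableOn_line (n : ℕ) {F : ℂ → ℂ} (hF : DifferentiableOn ℂ F {z | 0 < z.im})
    (hinf : DecaysAt (n + 2) F 1 0 0 1) {a b c d : ℝ} (hc : c ≠ 0) (hdet : a * d - b * c = 1)
    (hcusp : DecaysAt (n + 2) F a b c d) (α β : ℂ) :
    IntegrableOn (fun t : ℝ ↦ F ((a / c : ℝ) + I * t) * (((a / c : ℝ) + I * t) * α - β) ^ n)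
      (Set.Ioi 0) := by
  set x : ℝ := a / c with hx
  have hcont : ContinuousOn (fun t : ℝ ↦ F (x + I * t) * ((x + I * t) * α - β) ^ n)
      (Set.Ioi 0) := by
    refine ContinuousOn.mul (hF.continuousOn.comp (by fun_prop) fun t ht ↦ ?_) (by fun_prop)
    exact im_line_pos ht
  have htop : (fun t : ℝ ↦ F (x + I * t) * ((x + I * t) * α - β) ^ n)
      =O[atTop] fun t : ℝ ↦ t ^ (-2 : ℝ) := by
    obtain ⟨C, δ, A, hδ, hC⟩ := hinf
    have h1 : (fun t : ℝ ↦ F (x + I * t)) =O[atTop] fun t : ℝ ↦ t ^ (-(n + 2) : ℝ) := by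
      refine IsBigO.trans (IsBigO.of_bound C ?_) (isLittleO_exp_neg_mul_rpow_atTop hδ _).isBigO
      filter_upwards [eventually_ge_atTop A] with t ht
      simpa using hC (x + I * t) (by simpa using ht)
    have h2 : (fun t : ℝ ↦ ((x + I * t) * α - β) ^ n) =O[atTop] fun t : ℝ ↦ t ^ (n : ℝ) := by
      simp_rw [Real.rpow_natCast]
      refine IsBigO.pow (IsBigO.of_bound (‖x * α - β‖ + ‖α‖) ?_) n
      filter_upwards [eventually_ge_atTop 1] with t ht
      rw [Real.norm_of_nonneg (by linarith)]
      calc ‖(x + I * t) * α - β‖ = ‖(x * α - β) + I * t * α‖ := by ring_nf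
        _ ≤ ‖x * α - β‖ + t * ‖α‖ := by
          refine (norm_add_le _ _).trans ?_
          simp [abs_of_nonneg (zero_le_one.trans ht)]
        _ ≤ ‖x * α - β‖ * t + t * ‖α‖ := by
          gcongr
          exact le_mul_of_one_le_right (norm_nonneg _) ht
        _ = _ := by ring
    refine (h1.mul h2).congr' EventuallyEq.rfl ?_
    filter_upwards [eventually_gt_atTop 0] with t ht
    rw [← Real.rpow_add ht]
    congr 1
    ring
  have hbot : (fun t : ℝ ↦ F (x + I * t) * ((x + I * t) * α - β) ^ n)
      =O[𝓝[>] 0] fun t : ℝ ↦ t ^ (-0 : ℝ) := by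
    simp_rw [neg_zero, Real.rpow_zero]
    have h2 : (fun t : ℝ ↦ ((x + I * t) * α - β) ^ n) =O[𝓝[>] 0] fun _ ↦ (1 : ℝ) :=
      ((show Continuous fun t : ℝ ↦ ((x + I * t) * α - β) ^ n by fun_prop).tendsto 0).isBigO_one ℝ
        |>.mono nhdsWithin_le_nhds
    suffices h1 : (fun t : ℝ ↦ F (x + I * t)) =O[𝓝[>] 0] fun _ ↦ (1 : ℝ) by
      simpa using h1.mul h2
    obtain ⟨C, δ, A, hδ, hC⟩ := hcusp
    have hinv : Tendsto (fun t : ℝ ↦ (c ^ 2 * t)⁻¹) (𝓝[>] 0) atTop := by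
      refine tendsto_inv_nhdsGT_zero.comp (tendsto_nhdsWithin_iff.2 ⟨?_, ?_⟩)
      · exact (Continuous.tendsto' (by fun_prop) _ _ (by simp)).mono_left nhdsWithin_le_nhds
      · filter_upwards [self_mem_nhdsWithin] with t (ht : 0 < t)
        exact mul_pos (pow_pos (abs_pos.2 hc) 2 |>.trans_eq (sq_abs c)) ht
    have hlim : (fun s : ℝ ↦ C * (s ^ (n + 2 : ℝ) * |c| ^ (n + 2) * Real.exp (-δ * s)))
        =O[atTop] fun _ ↦ (1 : ℝ) := by
      have := (tendsto_rpow_mul_exp_neg_mul_atTop_nhds_zero (n + 2) δ hδ).const_mul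
        (C * |c| ^ (n + 2))
      refine (this.isBigO_one ℝ).congr_left fun s ↦ by ring
    refine IsBigO.trans (IsBigO.of_bound 1 ?_) (hlim.comp_tendsto hinv)
    filter_upwards [self_mem_nhdsWithin, hinv.eventually_ge_atTop A] with t (ht : 0 < t) hA
    set z : ℂ := -d / c + I * ((c ^ 2 * t)⁻¹ : ℝ) with hz
    have hzim : z.im = (c ^ 2 * t)⁻¹ := by
      have : (-d / c : ℂ) = ((-d / c : ℝ) : ℂ) := by push_cast; rfl
      rw [hz, this, Complex.add_im, ofReal_im, zero_add, I_mul_im, ofReal_re]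
    have hc' : (c : ℂ) ≠ 0 := by exact_mod_cast hc
    have ht' : (t : ℂ) ≠ 0 := by exact_mod_cast ht.ne'
    have hden : c * z + d = c * I * ((c ^ 2 * t)⁻¹ : ℝ) := by
      rw [hz]
      field_simp
      ring
    have hmob : (a * z + b) / (c * z + d) = x + I * t := by
      have hdet' : (a * d - b * c : ℂ) = 1 := by exact_mod_cast hdet
      rw [hden, hz, hx]
      push_cast
      field_simp
      linear_combination (-(c : ℂ) * t) * hdet' - (c : ℂ) * t * I_sq
    have := hC z (hzim ▸ hA)
    rw [hmob, hden, hzim] at this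
    refine this.trans ((le_abs_self _).trans_eq ?_)
    have h0 : 0 ≤ (c ^ 2 * t)⁻¹ := by positivity
    rw [one_mul, ← Real.norm_eq_abs, Function.comp_apply]
    congr 1
    rw [norm_mul, norm_mul, norm_I, norm_real, norm_real, Real.norm_of_nonneg h0,
      show (n + 2 : ℝ) = ((n + 2 : ℕ) : ℝ) by push_cast; rfl, Real.rpow_natCast,
      Real.norm_eq_abs]
    ring
  have := mellinConvergent_of_isBigO_rpow (s := 1)
    (hcont.locallyIntegrableOn measurableSet_Ioi) htop (by norm_num) hbot (by norm_num)
  simpa [MellinConvergent] using this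

/-- The integral of a derivative along a vertical line as a symmetric limit. -/
lemma tendsto_sub_line {G h : ℝ → ℂ} (hG : ∀ t, 0 < t → HasDerivAt G (h t) t)
    (hint : IntegrableOn h (Set.Ioi 0)) {m : ℝ} (hm : 0 < m) :
    Tendsto (fun T : ℝ ↦ G T - G (m / T)) atTop (𝓝 (∫ t in Set.Ioi (0 : ℝ), h t)) := by
  have h0 : Tendsto (fun T : ℝ ↦ m / T) atTop (𝓝 0) := tendsto_const_nhds.div_atTop tendsto_id
  have hlim := ((aecover_Ioi_of_Ioi (μ := volume) h0).inter
    ((aecover_Iic (μ := volume) tendsto_id).restrict)).integral_tendsto_of_countably_generated hint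
  refine hlim.congr' ?_
  filter_upwards [eventually_gt_atTop 0, eventually_ge_atTop m, eventually_ge_atTop 1]
    with T hT hTm hT1
  have hle : m / T ≤ T := (div_le_iff₀ hT).2 (by nlinarith)
  have hmT : 0 < m / T := by positivity
  rw [Set.Ioi_inter_Iic, id, Measure.restrict_restrict measurableSet_Ioc,
    Set.inter_eq_left.2 (show Set.Ioc (m / T) T ⊆ Set.Ioi 0 from fun t ht ↦ hmT.trans ht.1),
    ← intervalIntegral.integral_of_le hle]
  refine intervalIntegral.integral_eq_sub_of_hasDerivAt (fun t ht ↦ hG t ?_) ?_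
  · rw [Set.uIcc_of_le hle] at ht
    exact hmT.trans_le ht.1
  · rw [intervalIntegrable_iff_integrableOn_Ioc_of_le hle]
    exact hint.mono_set fun t ht ↦ hmT.trans ht.1

lemma IsPrimitive.tendsto_line {n : ℕ} {F G : ℂ → ℂ} {α β : ℂ} (hG : IsPrimitive n F α β G)
    {x : ℝ} (hint : IntegrableOn (fun t : ℝ ↦ F (x + I * t) * ((x + I * t) * α - β) ^ n)
      (Set.Ioi 0)) {m : ℝ} (hm : 0 < m) :
    Tendsto (fun T : ℝ ↦ G (x + I * T) - G (x + I * (m / T : ℝ))) atTop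
      (𝓝 (I * ∫ t in Set.Ioi (0 : ℝ), F (x + I * t) * ((x + I * t) * α - β) ^ n)) := by
  rw [← integral_const_mul]
  refine tendsto_sub_line (G := fun t : ℝ ↦ G (x + I * t)) (fun t ht ↦ ?_) (hint.const_mul I) hm
  have hline : HasDerivAt (fun t : ℂ ↦ x + I * t) I (t : ℂ) := by
    simpa using ((hasDerivAt_id (t : ℂ)).const_mul I).const_add (x : ℂ)
  rw [mul_comm I]
  exact HasDerivAt.comp_ofReal (e := G ∘ fun t : ℂ ↦ x + I * t)
    ((hG _ (im_line_pos ht)).comp (t : ℂ) hline)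

lemma IsPrimitive.comp_moebius {n : ℕ} {F G : ℂ → ℂ} {α β : ℂ} (hG : IsPrimitive n F α β G)
    {a b c d : ℝ} (hdet : a * d - b * c = 1)
    (hinv : ∀ z : ℂ, 0 < z.im → F ((a * z + b) / (c * z + d)) = (c * z + d) ^ (n + 2) * F z) :
    IsPrimitive n F (a * α - c * β) (d * β - b * α) fun z ↦ G ((a * z + b) / (c * z + d)) := by
  intro z hz
  have h := hG.hasDerivAt_moebius hdet hz
  rwa [hinv z hz, mul_right_comm (_ ^ _), mul_inv_cancel₀ (pow_ne_zero _
    (moebius_denom_ne_zero hdet hz)), one_mul,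
    show ∀ w : ℂ, w + (b * α - d * β) = w - (d * β - b * α) from fun w ↦ by ring] at h

/-- The integral along the vertical line through `1 / c` in terms of integrals along the
imaginary axis, for `F` invariant under `(1, 0; c, 1)`. -/
lemma integral_line_eq (n : ℕ) {F : ℂ → ℂ} (hF : DifferentiableOn ℂ F {z | 0 < z.im})
    (hinf : DecaysAt (n + 2) F 1 0 0 1) (hzero : DecaysAt (n + 2) F 0 (-1) 1 0)
    {c : ℝ} (hc : c ≠ 0) (hcusp : DecaysAt (n + 2) F 1 0 c 1)
    (hinv : ∀ z : ℂ, 0 < z.im → F (z / (c * z + 1)) = (c * z + 1) ^ (n + 2) * F z) (α β : ℂ) :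
    I * ∫ t in Set.Ioi (0 : ℝ), F ((1 / c : ℝ) + I * t) * (((1 / c : ℝ) + I * t) * α - β) ^ n
      = I * (∫ t in Set.Ioi (0 : ℝ), F (I * t) * (I * t * α - β) ^ n)
        - I * ∫ t in Set.Ioi (0 : ℝ), F (I * t) * (I * t * (α - c * β) - β) ^ n := by
  have hc' : (c : ℂ) ≠ 0 := by exact_mod_cast hc
  obtain ⟨G, hG⟩ := exists_isPrimitive n hF α β
  have hdet : (1 : ℝ) * 1 - 0 * c = 1 := by simp
  have hG' : IsPrimitive n F (α - c * β) β fun z ↦ G (z / (c * z + 1)) := by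
    simpa using hG.comp_moebius hdet (by simpa using hinv)
  have hA := hG.tendsto_line (integrableOn_line n hF hinf hc hdet hcusp α β)
    (m := (c ^ 2)⁻¹) (by positivity)
  have hint (α' : ℂ) := integrableOn_line n hF hinf one_ne_zero (by norm_num) hzero α' β
  have hB := hG.tendsto_line (hint α) one_pos
  have hD := hG'.tendsto_line (hint _) one_pos
  have hW₁ := hG.tendsto_sub_horocycle (by norm_num) hinf (1 / c)
  have hW₂ := hG.tendsto_sub_horocycle (by norm_num) hzero (-c)
  have hW₃ := hG.tendsto_sub_horocycle hdet hcusp (-(1 / c))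
  simp only [zero_div, ofReal_zero, zero_add] at hB hD
  have h := tendsto_nhds_unique (((hA.sub hB).add hD).congr' ?_) ((hW₁.sub hW₃).sub hW₂)
  · linear_combination h
  filter_upwards [eventually_gt_atTop 0] with T hT
  have hT' : (T : ℂ) ≠ 0 := by exact_mod_cast hT.ne'
  have e₁ : (((1 : ℝ) : ℂ) * (I * T + (-(1 / c) : ℝ)) + (0 : ℝ))
      / (c * (I * T + (-(1 / c) : ℝ)) + (1 : ℝ)) = (1 / c : ℝ) + I * ((c ^ 2)⁻¹ / T : ℝ) := by
    have : (c : ℂ) * (I * T + (-(1 / c) : ℝ)) + (1 : ℝ) = c * I * T := by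
      push_cast
      field_simp
      ring
    rw [this]
    push_cast
    field_simp
    linear_combination -I_sq
  have e₂ : (((0 : ℝ) : ℂ) * (I * T + (-c : ℝ)) + (-1 : ℝ))
        / ((1 : ℝ) * (I * T + (-c : ℝ)) + (0 : ℝ))
      = I * (1 / T : ℝ) / (c * (I * (1 / T : ℝ)) + 1) := by
    have h₁ : (((1 : ℝ) : ℂ) * (I * T + (-c : ℝ)) + (0 : ℝ)) = I * (T + c * I) := by
      push_cast
      linear_combination -c * I_sq
    have h₂ : (c * (I * (1 / T : ℝ)) + 1 : ℂ) = (T + c * I) / T := by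
      push_cast
      field_simp
      ring
    have h₃ : (T + c * I : ℂ) ≠ 0 := fun h ↦ hT.ne' (by simpa using congrArg re h)
    rw [h₁, h₂]
    push_cast
    field_simp
    linear_combination -(T + c * I : ℂ)⁻¹ * I_sq
  have e₃ : (((0 : ℝ) : ℂ) * (I * T) + (-1 : ℝ)) / ((1 : ℝ) * (I * T) + (0 : ℝ)) = I * (1 / T : ℝ) := by
    push_cast
    field_simp
    linear_combination -(T : ℂ) * I_sq
  rw [e₁, e₂, e₃]
  push_cast
  simp only [one_mul, zero_mul, zero_add, add_zero, div_one]
  ring_nf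

/-- The lower unipotent matrix `(1, 0; c, 1)`. -/
def lowerUnipotent (c : ℤ) : SL(2, ℤ) := ⟨!![1, 0; c, 1], by simp⟩

lemma lowerUnipotent_mem_gamma0 {N : ℕ} {c : ℤ} (hc : (N : ℤ) ∣ c) :
    lowerUnipotent c ∈ Gamma0 N := by
  rw [Gamma0_mem]
  simpa [lowerUnipotent] using (ZMod.intCast_zmod_eq_zero_iff_dvd c N).2 hc

lemma CuspForm.decaysAt_infty {N n : ℕ} [NeZero N] (f : CuspForm (Gamma0 N) ((n + 2 : ℕ) : ℤ)) :
    DecaysAt (n + 2) (fval f) 1 0 0 1 := by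
  simpa using f.decaysAt 1

lemma CuspForm.decaysAt_zero {N n : ℕ} [NeZero N] (f : CuspForm (Gamma0 N) ((n + 2 : ℕ) : ℤ)) :
    DecaysAt (n + 2) (fval f) 0 (-1) 1 0 := by
  simpa [ModularGroup.S] using f.decaysAt ModularGroup.S

lemma CuspForm.decaysAt_one_div {N n : ℕ} [NeZero N] (f : CuspForm (Gamma0 N) ((n + 2 : ℕ) : ℤ))
    (c : ℤ) : DecaysAt (n + 2) (fval f) 1 0 c 1 := by
  simpa [lowerUnipotent] using f.decaysAt (lowerUnipotent c)

lemma CuspForm.fval_add_one {N n : ℕ} (f : CuspForm (Gamma0 N) ((n + 2 : ℕ) : ℤ)) {z : ℂ}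
    (hz : 0 < z.im) : fval f (z + 1) = fval f z := by
  simpa [ModularGroup.T] using fval_gamma0 f (γ := ModularGroup.T)
    (by rw [Gamma0_mem]; simp [ModularGroup.T]) hz

lemma CuspForm.integral_line_eq {N n : ℕ} [NeZero N] (f : CuspForm (Gamma0 N) ((n + 2 : ℕ) : ℤ))
    {c : ℤ} (hc : c ≠ 0) (hN : (N : ℤ) ∣ c) (α β : ℂ) :
    IntegrableOn (fun t : ℝ ↦
      fval f ((1 / c : ℝ) + I * t) * (((1 / c : ℝ) + I * t) * α - β) ^ n) (Set.Ioi 0) ∧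
    I * ∫ t in Set.Ioi (0 : ℝ), fval f ((1 / c : ℝ) + I * t) * (((1 / c : ℝ) + I * t) * α - β) ^ n
      = rPoly (n + 2) f β α - rPoly (n + 2) f β (α - c * β) := by
  have hc' : (c : ℝ) ≠ 0 := by exact_mod_cast hc
  refine ⟨integrableOn_line n f.differentiableOn_fval f.decaysAt_infty hc' (by norm_num)
    (f.decaysAt_one_div c) α β, ?_⟩
  have h := _root_.integral_line_eq n f.differentiableOn_fval f.decaysAt_infty f.decaysAt_zero hc'
    (f.decaysAt_one_div c) (fun z hz ↦ ?_) α β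
  · rw [h]
    simp [rPoly]
  · simpa [lowerUnipotent] using fval_gamma0 f (lowerUnipotent_mem_gamma0 hN) hz

lemma rPoly_neg_neg {n : ℕ} (hn : Even n) (f : UpperHalfPlane → ℂ) (x y : ℂ) :
    rPoly (n + 2) f (-x) (-y) = rPoly (n + 2) f x y := by
  simp only [rPoly, Nat.add_sub_cancel]
  congr 2 with t
  rw [← hn.neg_pow (I * t * y - x)]
  ring_nf

/-- Lemma: the period polynomial of `f|U₃` for a cusp form `f` of weight `k` on `Γ₀(3)`
satisfies `r_{f|U₃}(x,y) = r_f(x,3y) + r_f(x+y,3y) - r_f(x+y,-3x) + r_f(x-y,3y)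
- r_f(-(x-y),-3x)`. -/
theorem stmt5 (k : ℕ) (hk : 4 ≤ k) (hke : Even k)
    (f g : CuspForm (Gamma0 3) (k : ℤ))
    (hg : ∀ z : ℂ, 0 < z.im →
      fval g z = (1 / 3) * (fval f (z / 3) + fval f ((z + 1) / 3) + fval f ((z + 2) / 3))) :
    ∀ x y : ℂ, rPoly k g x y
      = rPoly k f x (3 * y) + rPoly k f (x + y) (3 * y) - rPoly k f (x + y) (-3 * x)
        + rPoly k f (x - y) (3 * y) - rPoly k f (-(x - y)) (-3 * x) := by
  intro x y
  obtain ⟨n, rfl⟩ : ∃ n, k = n + 2 := ⟨k - 2, by omega⟩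
  obtain ⟨hint₁, h₁⟩ := f.integral_line_eq (c := 3) (by norm_num) (by norm_num) (3 * y) (x + y)
  obtain ⟨hint₂, h₂⟩ := f.integral_line_eq (c := -3) (by norm_num) (by norm_num) (3 * y) (x - y)
  have hint₀ : IntegrableOn (fun t : ℝ ↦ fval f (I * t) * (I * t * (3 * y) - x) ^ n)
      (Set.Ioi 0) := by
    simpa using integrableOn_line n f.differentiableOn_fval f.decaysAt_infty one_ne_zero
      (by norm_num) f.decaysAt_zero (3 * y) x
  have hg' : rPoly (n + 2) g x y = rPoly (n + 2) f x (3 * y)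
      + I * (∫ t in Set.Ioi (0 : ℝ), fval f ((1 / (3 : ℤ) : ℝ) + I * t)
        * (((1 / (3 : ℤ) : ℝ) + I * t) * (3 * y) - (x + y)) ^ n)
      + I * ∫ t in Set.Ioi (0 : ℝ), fval f ((1 / (-3 : ℤ) : ℝ) + I * t)
        * (((1 / (-3 : ℤ) : ℝ) + I * t) * (3 * y) - (x - y)) ^ n := by
    simp only [rPoly, Nat.add_sub_cancel]
    have hint : IntegrableOn (fun t : ℝ ↦ fval f (I * t) * (I * t * (3 * y) - x) ^ n
        + fval f ((1 / (3 : ℤ) : ℝ) + I * t)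
          * (((1 / (3 : ℤ) : ℝ) + I * t) * (3 * y) - (x + y)) ^ n) (Set.Ioi 0) :=
      hint₀.add hint₁
    rw [← mul_add, ← mul_add, ← integral_add hint₀ hint₁, ← integral_add hint hint₂]
    have hsub := integral_comp_mul_left_Ioi' (fun t : ℝ ↦ fval g (I * t) * (I * t * y - x) ^ n) 0
      (b := 3) (by norm_num)
    rw [mul_zero] at hsub
    rw [← hsub, ← integral_smul]
    congr 1
    refine setIntegral_congr_fun measurableSet_Ioi fun t (ht : 0 < t) ↦ ?_
    have hz : 0 < (I * (3 * t : ℝ) : ℂ).im := by simpa using ht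
    have e₀ : (I * (3 * t : ℝ) : ℂ) / 3 = I * t := by push_cast; ring
    have e₁ : (I * (3 * t : ℝ) + 1 : ℂ) / 3 = (1 / (3 : ℤ) : ℝ) + I * t := by push_cast; ring
    have e₂ : (I * (3 * t : ℝ) + 2 : ℂ) / 3 = (1 / (-3 : ℤ) : ℝ) + I * t + 1 := by
      push_cast
      ring
    rw [hg _ hz, e₀, e₁, e₂, f.fval_add_one (im_line_pos ht), real_smul]
    push_cast
    ring_nf
  have hswap : rPoly (n + 2) f (-(x - y)) (-3 * x) = rPoly (n + 2) f (x - y) (3 * x) := by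
    rw [neg_mul, rPoly_neg_neg ((Nat.even_add.1 hke).2 even_two)]
  rw [hg', h₁, h₂, hswap, show 3 * y - ((3 : ℤ) : ℂ) * (x + y) = -3 * x by push_cast; ring,
    show 3 * y - ((-3 : ℤ) : ℂ) * (x - y) = 3 * x by push_cast; ring]
  ring
end
end
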